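/- There exists an absolute constant C ≥ 1 such that for every integer d ≥ 2 and every integer n with 2 ln d ≤ n ≤ (d² · (ln ln d)²)/(ln d)², one has disp*(n, d) ≤ ((C · ln d / n) · ln(n / ln d))^{1/2}. -/

import Mathlib

open MeasureTheory Set

noncomputable section

/-- The unit cube `Q_d = [0,1]^d`. -/
def cube (d : ℕ) : Set (Fin d → ℝ) := Set.univ.pi fun _ => Set.Icc (0 : ℝ) 1

/-- `B` is an axis-parallel box `∏ [aᵢ, bᵢ)` contained in the unit cube. -/
def IsBox {d : ℕ} (B : Set (Fin d → ℝ)) : Prop :=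
  ∃ a b : Fin d → ℝ, (∀ i, 0 ≤ a i ∧ a i ≤ b i ∧ b i ≤ 1) ∧
    B = Set.univ.pi fun i => Set.Ico (a i) (b i)

/-- Dispersion of a point set `P ⊆ Q_d`: the supremum of volumes of boxes avoiding `P`. -/
def disp {d : ℕ} (P : Set (Fin d → ℝ)) : ℝ :=
  sSup {v : ℝ | ∃ B : Set (Fin d → ℝ), IsBox B ∧ B ∩ P = ∅ ∧ v = (volume B).toReal}

/-- Minimal dispersion `disp*(n,d)` over all `n`-point subsets of the cube. -/
def minDisp (n d : ℕ) : ℝ :=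
  sInf {v : ℝ | ∃ P : Finset (Fin d → ℝ),
    ↑P ⊆ cube d ∧ P.card = n ∧ v = disp (↑P : Set (Fin d → ℝ))}

lemma aux_prod {ι : Type*} (s : Finset ι) (l : ι → ℝ) (q : ℝ) (hq0 : 0 ≤ q) (hq1 : q < 1)
    (h : ∀ i ∈ s, q ≤ l i ∧ l i ≤ 1) :
    (∏ i ∈ s, l i - q) / (1 - q) ≤ ∏ i ∈ s, ((l i - q) / (1 - q)) := by
  classical
  have hq : 0 < 1 - q := by linarith
  induction s using Finset.induction_on with
  | empty => simp [div_self hq.ne']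
  | insert a s ha ih =>
    rw [Finset.prod_insert ha, Finset.prod_insert ha]
    have h1 := h a (Finset.mem_insert_self _ _)
    have h2 : ∀ i ∈ s, q ≤ l i ∧ l i ≤ 1 := fun i hi => h i (Finset.mem_insert_of_mem hi)
    have hP : ∏ i ∈ s, l i ≤ 1 :=
      Finset.prod_le_one (fun i hi => hq0.trans (h2 i hi).1) (fun i hi => (h2 i hi).2)
    set P := ∏ i ∈ s, l i
    calc (l a * P - q) / (1 - q) ≤ (l a - q) / (1 - q) * ((P - q) / (1 - q)) := by
          rw [div_mul_div_comm, div_le_div_iff₀ hq (by positivity)]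
          have : 0 ≤ q * ((1 - l a) * (1 - P)) :=
            mul_nonneg hq0 (mul_nonneg (by linarith) (by linarith))
          have h3 : 0 ≤ (q * ((1 - l a) * (1 - P))) * (1 - q) := mul_nonneg this hq.le
          nlinarith [h3]
      _ ≤ _ := mul_le_mul_of_nonneg_left (ih h2) (div_nonneg (by linarith) hq.le)

lemma aux_hit {X T : Type*} [Fintype X] [Fintype T] [DecidableEq X] [Nonempty X]
    (S : T → Finset X) (p : ℝ) (hp : p ≤ 1) (n : ℕ)
    (hn : (Fintype.card T : ℝ) * (1 - p) ^ n < 1) :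
    ∃ f : Fin n → X, ∀ t, p * Fintype.card X ≤ (S t).card → ∃ i, f i ∈ S t := by
  classical
  by_contra hcon
  push Not at hcon
  let G : Finset T := Finset.univ.filter fun t => p * Fintype.card X ≤ (S t).card
  have hsub : (Finset.univ : Finset (Fin n → X)) ⊆
      G.biUnion fun t => Fintype.piFinset fun _ => (S t)ᶜ := by
    intro f _
    obtain ⟨t, ht, h⟩ := hcon f
    simp only [Finset.mem_biUnion, Fintype.mem_piFinset, Finset.mem_compl]
    exact ⟨t, by simp [G, ht], h⟩
  have h1 := (Finset.card_le_card hsub).trans Finset.card_biUnion_le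
  have hX : (0 : ℝ) < Fintype.card X := by exact_mod_cast Fintype.card_pos
  have h2 : ((Fintype.card X : ℝ)) ^ n ≤
      ∑ t ∈ G, ((1 - p) * Fintype.card X) ^ n := by
    have h3 : ((Fintype.card X : ℝ)) ^ n ≤
      ∑ t ∈ G, (((S t)ᶜ.card : ℝ)) ^ n := by
      have : Fintype.card X ^ n ≤ ∑ t ∈ G, (S t)ᶜ.card ^ n := by
        simpa [Fintype.card_piFinset] using h1
      exact_mod_cast this
    refine h3.trans (Finset.sum_le_sum fun t ht => ?_)
    have ht' : p * Fintype.card X ≤ (S t).card := by simpa [G] using ht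
    refine pow_le_pow_left₀ (by positivity) ?_ n
    rw [Finset.card_compl, Nat.cast_sub (Finset.card_le_univ _)]
    linarith
  rw [Finset.sum_const, nsmul_eq_mul, mul_pow, ← mul_assoc] at h2
  have hG : (G.card : ℝ) ≤ Fintype.card T := by exact_mod_cast Finset.card_le_univ _
  have h4 : (G.card : ℝ) * (1 - p) ^ n < 1 :=
    lt_of_le_of_lt (mul_le_mul_of_nonneg_right hG (pow_nonneg (by linarith) n)) hn
  have h5 : (0:ℝ) < (Fintype.card X : ℝ) ^ n := by positivity
  nlinarith

/-- interval on the grid -/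
def gset (M lo hi : ℕ) : Finset (Fin M) := Finset.univ.filter fun j => lo ≤ j.1 ∧ j.1 < hi

lemma gset_card (M lo hi : ℕ) (hhi : hi ≤ M) : (gset M lo hi).card = hi - lo := by
  rw [← Nat.card_Ico, ← Finset.card_map (f := Fin.valEmbedding)]
  congr 1
  ext t
  simp only [gset, Finset.mem_map, Finset.mem_filter, Finset.mem_univ, true_and, Finset.mem_Ico,
    Fin.valEmbedding_apply]
  constructor
  · rintro ⟨j, hj, rfl⟩; exact hj
  · intro h; exact ⟨⟨t, by omega⟩, h, rfl⟩

def ge (M : ℕ) (a : ℝ) : ℕ := ⌈a * (M + 1)⌉₊ - 1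

lemma ge_le (M : ℕ) (a : ℝ) (ha : a ≤ 1) : ge M a ≤ M := by
  have : ⌈a * (M + 1)⌉₊ ≤ M + 1 := by
    rw [Nat.ceil_le]; push_cast
    nlinarith [(Nat.cast_nonneg M : (0:ℝ) ≤ M)]
  unfold ge; omega

lemma mem_iff1 (M j : ℕ) (a : ℝ) : a ≤ ((j:ℝ) + 1) / (M + 1) ↔ ge M a ≤ j := by
  have hM : (0:ℝ) < M + 1 := by positivity
  rw [le_div_iff₀ hM]
  have : a * (M + 1) ≤ (j:ℝ) + 1 ↔ ⌈a * (M + 1)⌉₊ ≤ j + 1 := by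
    rw [Nat.ceil_le]; push_cast; rfl
  rw [this]; unfold ge; omega

lemma mem_iff2 (M j : ℕ) (b : ℝ) : ((j:ℝ) + 1) / (M + 1) < b ↔ j < ge M b := by
  rw [← not_le, mem_iff1, not_le]

lemma ge_diff (M : ℕ) (a b : ℝ) (ha : 0 ≤ a) (hb : 0 ≤ b) :
    (b - a) * (M + 1) - 1 ≤ ((ge M b - ge M a : ℕ) : ℝ) := by
  have hM : (0:ℝ) < M + 1 := by positivity
  have h1 := Nat.le_ceil (b * ((M:ℝ) + 1))
  have h2 := Nat.ceil_lt_add_one (mul_nonneg ha hM.le)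
  have h3 : 0 ≤ a * ((M:ℝ) + 1) := mul_nonneg ha hM.le
  unfold ge
  rcases Nat.eq_zero_or_pos ⌈a * ((M:ℝ) + 1)⌉₊ with h | h
  · rw [h]
    have : (⌈b * ((M:ℝ) + 1)⌉₊ : ℝ) ≤ ((⌈b * ((M:ℝ) + 1)⌉₊ - 1 - (0 - 1) : ℕ) : ℝ) + 1 := by
      exact_mod_cast (by omega)
    nlinarith
  · have : (⌈b * ((M:ℝ) + 1)⌉₊ : ℝ) ≤
      ((⌈b * ((M:ℝ) + 1)⌉₊ - 1 - (⌈a * ((M:ℝ) + 1)⌉₊ - 1) : ℕ) : ℝ) + ⌈a * ((M:ℝ) + 1)⌉₊ := by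
      rw [← Nat.cast_add, Nat.cast_le]; omega
    nlinarith

lemma ge_full (M : ℕ) (a b : ℝ) (ha : 0 ≤ a) (hb : b ≤ 1) (h : 1 - 1 / ((M:ℝ) + 1) < b - a) :
    ge M a = 0 ∧ M ≤ ge M b := by
  have hM : (0:ℝ) < M + 1 := by positivity
  have h' : (M : ℝ) < (b - a) * (M + 1) := by
    have := mul_lt_mul_of_pos_right h hM
    rw [sub_mul, div_mul_cancel₀ _ hM.ne'] at this
    linarith
  constructor
  · have : ⌈a * ((M:ℝ) + 1)⌉₊ ≤ 1 := by
      rw [Nat.ceil_le]; push_cast; nlinarith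
    unfold ge; omega
  · have : M < ⌈b * ((M:ℝ) + 1)⌉₊ := by
      rw [Nat.lt_ceil]; nlinarith
    unfold ge; omega

lemma exists_cover {d K : ℕ} (hd : 0 < d) (A : Finset (Fin d)) (hA : A.card ≤ K) :
    ∃ e : Fin K → Fin d, ∀ i ∈ A, ∃ k, e k = i := by
  classical
  refine ⟨fun k => if h : k.1 < A.card then (A.equivFin.symm ⟨k.1, h⟩).1 else ⟨0, hd⟩, ?_⟩
  intro i hi
  refine ⟨⟨(A.equivFin ⟨i, hi⟩).1, (A.equivFin ⟨i, hi⟩).2.trans_le hA⟩, ?_⟩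
  simp

/-- Combinatorial core. -/
lemma core (d M K n : ℕ) (ε : ℝ) (hd : 0 < d) (hM : 0 < M) (hε0 : 0 < ε) (hε1 : ε < 1)
    (hMε : 2 / ε ≤ (M:ℝ) + 1) (hK : ((M:ℝ) + 1) * Real.log (1 / ε) ≤ K + 1)
    (hcount : ((d : ℝ) * ((M + 1) * (M + 1))) ^ K * (1 - ε / 2) ^ n < 1) :
    ∃ f : Fin n → (Fin d → ℝ), (∀ i, f i ∈ cube d) ∧
      ∀ a b : Fin d → ℝ, (∀ i, 0 ≤ a i ∧ a i ≤ b i ∧ b i ≤ 1) → ε < ∏ i, (b i - a i) →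
        ∃ i, f i ∈ Set.univ.pi fun j => Set.Ico (a j) (b j) := by
  classical
  have hm : (0:ℝ) < M + 1 := by positivity
  have : Nonempty (Fin M) := ⟨⟨0, hM⟩⟩
  let T := Fin K → Fin d × Fin (M + 1) × Fin (M + 1)
  let S : T → Finset (Fin d → Fin M) := fun g =>
    Finset.univ.filter fun x => ∀ k, x (g k).1 ∈ gset M (g k).2.1 (g k).2.2
  obtain ⟨f, hf⟩ := aux_hit S (ε / 2) (by linarith) n (by
    simpa [T, Fintype.card_fin] using hcount)
  refine ⟨fun i j => ((f i j : ℕ) + 1 : ℝ) / (M + 1), ?_, ?_⟩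
  · intro i j _
    constructor
    · positivity
    · show ((f i j : ℕ) + 1 : ℝ) / (M + 1) ≤ 1
      rw [div_le_one hm]
      have : ((f i j : ℕ) : ℝ) ≤ M := by exact_mod_cast (f i j).2.le
      linarith
  intro a b hab hvol
  let q : ℝ := 1 / ((M:ℝ) + 1)
  have hq0 : 0 < q := by positivity
  have hqε : q ≤ ε / 2 := by
    show 1 / ((M:ℝ) + 1) ≤ ε / 2
    rw [div_le_div_iff₀ hm two_pos]
    rw [div_le_iff₀ hε0] at hMε
    linarith
  have hl1 : ∀ i, b i - a i ≤ 1 := fun i => by linarith [(hab i).1, (hab i).2.2]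
  have hl0 : ∀ i, 0 ≤ b i - a i := fun i => by linarith [(hab i).2.1]
  have hlε : ∀ i, ε < b i - a i := by
    intro i
    refine hvol.trans_le ?_
    rw [← Finset.mul_prod_erase Finset.univ _ (Finset.mem_univ i)]
    exact mul_le_of_le_one_right (hl0 i)
      (Finset.prod_le_one (fun j _ => hl0 j) (fun j _ => hl1 j))
  -- active set
  let A : Finset (Fin d) := Finset.univ.filter fun i => b i - a i ≤ 1 - q
  have hA : A.card ≤ K := by
    have h1 : ε < (1 - q) ^ A.card := by
      refine hvol.trans_le ?_
      calc ∏ i, (b i - a i) ≤ ∏ i ∈ A, (b i - a i) := by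
            rw [← Finset.prod_sdiff (Finset.subset_univ A)]
            exact mul_le_of_le_one_left (Finset.prod_nonneg fun i _ => hl0 i)
              (Finset.prod_le_one (fun j _ => hl0 j) (fun j _ => hl1 j))
        _ ≤ ∏ i ∈ A, (1 - q) := Finset.prod_le_prod (fun i _ => hl0 i)
            (fun i hi => by simpa [A] using hi)
        _ = _ := by simp
    have h2 : (1 - q) ^ A.card ≤ Real.exp (-(q * A.card)) := by
      calc (1 - q) ^ A.card ≤ (Real.exp (-q)) ^ A.card :=
            pow_le_pow_left₀ (by linarith) (by linarith [Real.add_one_le_exp (-q)]) _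
        _ = _ := by rw [← Real.exp_nat_mul]; ring_nf
    have h3 : Real.log ε < -(q * A.card) := by
      rw [Real.log_lt_iff_lt_exp hε0]; exact h1.trans_le h2
    have h4 : q * A.card < Real.log (1 / ε) := by
      rw [one_div, Real.log_inv]; linarith
    have h5 : (A.card : ℝ) < K + 1 := by
      refine lt_of_lt_of_le ?_ hK
      have := mul_lt_mul_of_pos_left h4 hm
      have hmq : ((M:ℝ) + 1) * q = 1 := mul_one_div_cancel hm.ne'
      rwa [← mul_assoc, hmq, one_mul] at this
    have : A.card < K + 1 := by exact_mod_cast h5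
    omega
  obtain ⟨e, he⟩ := exists_cover hd A hA
  let g : T := fun k => (e k,
    ⟨ge M (a (e k)), Nat.lt_succ_of_le (ge_le M _ (by linarith [(hab (e k)).2.1, (hab (e k)).2.2]))⟩,
    ⟨ge M (b (e k)), Nat.lt_succ_of_le (ge_le M _ (hab (e k)).2.2)⟩)
  have hS : S g = Fintype.piFinset fun i => gset M (ge M (a i)) (ge M (b i)) := by
    ext x
    simp only [S, g, Finset.mem_filter, Finset.mem_univ, true_and, Fintype.mem_piFinset]
    constructor
    · intro h i
      by_cases hi : i ∈ A
      · obtain ⟨k, rfl⟩ := he i hi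
        exact h k
      · have hi' : 1 - 1 / ((M:ℝ) + 1) < b i - a i := by
          have := hi
          simp only [A, Finset.mem_filter, Finset.mem_univ, true_and, not_le] at this
          exact this
        obtain ⟨h1, h2⟩ := ge_full M (a i) (b i) (hab i).1 (hab i).2.2 hi'
        simp only [gset, Finset.mem_filter, Finset.mem_univ, true_and, h1]
        exact ⟨Nat.zero_le _, (x i).2.trans_le h2⟩
    · intro h k
      exact h (e k)
  have hq1 : q < 1 := by linarith
  have hM' : (0:ℝ) < M := by exact_mod_cast hM
  have hcard : ε / 2 * Fintype.card (Fin d → Fin M) ≤ (S g).card := by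
    rw [hS, Fintype.card_piFinset]
    have key := aux_prod Finset.univ (fun i => b i - a i) q hq0.le hq1
      (fun i _ => ⟨by linarith [hlε i], hl1 i⟩)
    have h1 : ε / 2 ≤ (∏ i, (b i - a i) - q) / (1 - q) := by
      rw [le_div_iff₀ (by linarith)]
      nlinarith
    have h2 : ∏ i, ((b i - a i - q) / (1 - q)) ≤
        ∏ i, (((gset M (ge M (a i)) (ge M (b i))).card : ℝ) / M) := by
      refine Finset.prod_le_prod (fun i _ => div_nonneg (by linarith [hlε i]) (by linarith)) ?_
      intro i _
      rw [gset_card _ _ _ (ge_le M _ (hab i).2.2)]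
      have h3 := ge_diff M (a i) (b i) (hab i).1 (by linarith [(hab i).1, (hab i).2.1])
      have h4 : (b i - a i - q) / (1 - q) = ((b i - a i) * (M + 1) - 1) / M := by
        have : 1 - q = M / (M + 1) := by
          show 1 - 1 / ((M:ℝ) + 1) = M / (M + 1)
          field_simp; ring
        rw [this]
        show (b i - a i - 1 / ((M:ℝ) + 1)) / (M / (M + 1)) = _
        field_simp
      rw [h4]
      gcongr
    have h5 := (h1.trans key).trans h2
    rw [Finset.prod_div_distrib] at h5
    simp only [Finset.prod_const, Finset.card_univ, Fintype.card_fin] at h5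
    rw [le_div_iff₀ (by positivity)] at h5
    simpa using h5
  obtain ⟨i, hi⟩ := hf g hcard
  refine ⟨i, fun j _ => ?_⟩
  rw [hS, Fintype.mem_piFinset] at hi
  have := hi j
  simp only [gset, Finset.mem_filter, Finset.mem_univ, true_and] at this
  exact ⟨(mem_iff1 M _ _).2 this.1, (mem_iff2 M _ _).2 this.2⟩

lemma box_vol {d : ℕ} (a b : Fin d → ℝ) (h : ∀ i, a i ≤ b i) :
    (volume (Set.univ.pi fun i => Set.Ico (a i) (b i))).toReal = ∏ i, (b i - a i) :=
  Real.volume_pi_Ico_toReal h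

lemma disp_nonneg {d : ℕ} (P : Set (Fin d → ℝ)) : 0 ≤ disp P := by
  apply Real.sSup_nonneg
  rintro v ⟨B, _, _, rfl⟩
  exact ENNReal.toReal_nonneg

lemma minDisp_le (n d : ℕ) (hd : 0 < d) (ε : ℝ) (hε : 0 ≤ ε) (f : Fin n → (Fin d → ℝ))
    (hf : ∀ i, f i ∈ cube d)
    (h : ∀ a b : Fin d → ℝ, (∀ i, 0 ≤ a i ∧ a i ≤ b i ∧ b i ≤ 1) → ε < ∏ i, (b i - a i) →
        ∃ i, f i ∈ Set.univ.pi fun j => Set.Ico (a j) (b j)) :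
    minDisp n d ≤ ε := by
  classical
  have hinf : (cube d).Infinite := by
    have : Nonempty (Fin d) := ⟨⟨0, hd⟩⟩
    have : (Set.Icc (0:ℝ) 1).Infinite := Set.Icc_infinite one_pos
    refine Set.Infinite.mono ?_ (this.image (f := fun (t : ℝ) (_ : Fin d) => t) ?_)
    · rintro _ ⟨t, ht, rfl⟩ i _
      exact ht
    · intro s _ t _ hst
      exact congrFun hst ⟨0, hd⟩
  obtain ⟨P, hP1, hP2, hP3⟩ : ∃ P : Finset (Fin d → ℝ), Finset.univ.image f ⊆ P ∧
      ↑P ⊆ cube d ∧ P.card = n := by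
    have hc : (Finset.univ.image f).card ≤ n := by
      simpa using Finset.card_image_le (s := Finset.univ) (f := f)
    obtain ⟨Q, hQ1, hQ2⟩ := Set.Infinite.exists_subset_card_eq
      (hinf.sdiff (Finset.finite_toSet (Finset.univ.image f))) (n - (Finset.univ.image f).card)
    refine ⟨Finset.univ.image f ∪ Q, Finset.subset_union_left, ?_, ?_⟩
    · intro y hy
      rcases Finset.mem_union.1 (Finset.mem_coe.1 hy) with hy | hy
      · obtain ⟨i, _, rfl⟩ := Finset.mem_image.1 hy
        exact hf i
      · exact (hQ1 hy).1
    · rw [Finset.card_union_of_disjoint, hQ2]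
      · omega
      · rw [Finset.disjoint_left]
        intro y hy hy'
        exact (hQ1 hy').2 hy
  have hle : minDisp n d ≤ disp (↑P : Set (Fin d → ℝ)) := by
    unfold minDisp
    refine csInf_le ⟨0, ?_⟩ ⟨P, hP2, hP3, rfl⟩
    rintro v ⟨P, _, _, rfl⟩
    exact disp_nonneg _
  refine hle.trans ?_
  · refine Real.sSup_le ?_ hε
    rintro v ⟨B, ⟨a, b, hab, rfl⟩, hB, rfl⟩
    rw [box_vol a b fun i => (hab i).2.1]
    by_contra hlt
    obtain ⟨i, hi⟩ := h a b hab (not_le.1 hlt)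
    have : f i ∈ (∅ : Set (Fin d → ℝ)) := by
      rw [← hB]
      exact ⟨hi, hP1 (Finset.mem_image_of_mem f (Finset.mem_univ i))⟩
    exact this

/-- There exists an absolute constant `C ≥ 1` such that for every integer `d ≥ 2` and every
integer `n` with `2 ln d ≤ n ≤ d²(ln ln d)²/(ln d)²`, one has
`disp*(n,d) ≤ ((C ln d / n) · ln(n / ln d))^{1/2}`. -/
theorem minimal_dispersion_bound_small_n :
    ∃ C : ℝ, 1 ≤ C ∧ ∀ d : ℕ, 2 ≤ d → ∀ n : ℕ,
      2 * Real.log d ≤ (n : ℝ) →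
      (n : ℝ) ≤ (d : ℝ) ^ 2 * Real.log (Real.log d) ^ 2 / Real.log d ^ 2 →
      minDisp n d ≤ (C * Real.log d / n * Real.log ((n : ℝ) / Real.log d)) ^ ((1 : ℝ) / 2) := by
  refine ⟨100, by norm_num, ?_⟩
  intro d hd n hn1 hn2
  have hd' : (2:ℝ) ≤ d := by exact_mod_cast hd
  have hL : 0.69 < Real.log d :=
    lt_of_lt_of_le (by linarith [Real.log_two_gt_d9]) (Real.log_le_log two_pos hd')
  set L := Real.log (d:ℝ) with hLdef
  have hL0 : 0 < L := by linarith
  have hn0 : (0:ℝ) < n := by linarith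
  set x := (n:ℝ) / L with hx
  have hx2 : 2 ≤ x := by rw [hx, le_div_iff₀ hL0]; exact hn1
  have hlx : 0.69 < Real.log x :=
    lt_of_lt_of_le (by linarith [Real.log_two_gt_d9]) (Real.log_le_log two_pos hx2)
  have hx0 : 0 < x := by linarith
  have hnd : (n:ℝ) ≤ (d:ℝ) ^ 2 := by
    refine hn2.trans ?_
    rw [div_le_iff₀ (by positivity)]
    refine mul_le_mul_of_nonneg_left ?_ (by positivity)
    refine sq_le_sq' ?_ ?_
    · have h1 := Real.log_le_log (by norm_num) hL.le
      have h2 := Real.one_sub_inv_le_log_of_pos (show (0:ℝ) < 0.69 by norm_num)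
      norm_num at h1 h2 hL ⊢
      linarith
    · linarith [Real.log_le_sub_one_of_pos hL0]
  rw [← Real.sqrt_eq_rpow]
  set E := 100 * L / n * Real.log x with hE
  have hEx : E = 100 * Real.log x / x := by
    rw [hE, hx]; field_simp
  have hE0 : 0 < E := by rw [hEx]; positivity
  set ε := Real.sqrt E with hε
  have hε0 : 0 < ε := Real.sqrt_pos.2 hE0
  have hεsq : ε ^ 2 = E := Real.sq_sqrt hE0.le
  have hd0 : 0 < d := by omega
  by_cases hε1 : ε < 1
  swap
  · push Not at hε1
    refine minDisp_le n d hd0 ε hε0.le (fun _ _ => 0) (fun i j _ => by simp) ?_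
    intro a b hab hv
    exfalso
    have : ∏ i, (b i - a i) ≤ 1 := Finset.prod_le_one
      (fun i _ => by linarith [(hab i).2.1]) (fun i _ => by linarith [(hab i).1, (hab i).2.2])
    linarith
  -- log (1/ε) ≤ log x / 2
  have hlog0 : 0 < Real.log (1 / ε) := Real.log_pos (by rw [lt_div_iff₀ hε0]; linarith)
  have hlog : 2 * Real.log (1 / ε) ≤ Real.log x := by
    have h1 : 2 * Real.log (1 / ε) = Real.log (x / (100 * Real.log x)) := by
      have : x / (100 * Real.log x) = (1 / ε) ^ 2 := by
        rw [div_pow, hεsq, hEx]; field_simp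
      rw [this, Real.log_pow]; norm_num
    rw [h1]
    refine Real.log_le_log (by positivity) (div_le_self hx0.le (by linarith))
  have hεd : 1 / ε ≤ d := by
    rw [div_le_iff₀ hε0]
    have h1 : 1 ≤ (d:ℝ) ^ 2 * ε ^ 2 := by
      have h2 : (n:ℝ) * E = 100 * L * Real.log x := by rw [hE]; field_simp
      have h3 : 1 ≤ (n:ℝ) * E := by rw [h2]; nlinarith
      rw [hεsq]
      exact h3.trans (mul_le_mul_of_nonneg_right hnd hE0.le)
    rw [← mul_pow] at h1
    by_contra hc
    push Not at hc
    have : 0 ≤ (d:ℝ) * ε := by positivity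
    nlinarith
  obtain ⟨M, hM0, hM1, hM2⟩ : ∃ M : ℕ, 0 < M ∧ 2 / ε ≤ (M:ℝ) + 1 ∧ (M:ℝ) + 1 ≤ 3 / ε := by
    have hi : 1 < 1 / ε := by rw [lt_div_iff₀ hε0]; linarith
    have e2 : 2 / ε = 2 * (1 / ε) := by ring
    have e3 : 3 / ε = 3 * (1 / ε) := by ring
    have h1 := Nat.le_ceil (2 / ε)
    have h2 := Nat.ceil_lt_add_one (show 0 ≤ 2 / ε by positivity)
    have h3 : 2 < ⌈2 / ε⌉₊ := by rw [Nat.lt_ceil]; push_cast; linarith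
    refine ⟨⌈2 / ε⌉₊ - 1, by omega, ?_, ?_⟩
    · rw [Nat.cast_sub (by omega)]; push_cast; linarith
    · rw [Nat.cast_sub (by omega)]; push_cast; linarith
  set K := ⌊((M:ℝ) + 1) * Real.log (1 / ε)⌋₊ with hK
  have hK1 : (K:ℝ) ≤ 3 / ε * Real.log (1 / ε) :=
    (Nat.floor_le (by positivity)).trans (mul_le_mul_of_nonneg_right hM2 hlog0.le)
  have hcount : ((d : ℝ) * ((M + 1) * (M + 1))) ^ K * (1 - ε / 2) ^ n < 1 := by
    have h1 : (d : ℝ) * ((M + 1) * (M + 1)) ≤ Real.exp (7 * L) := by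
      have hMd : (M:ℝ) + 1 ≤ 3 * d := by
        have e3 : 3 / ε = 3 * (1 / ε) := by ring
        linarith
      have : Real.exp (7 * L) = (d:ℝ) ^ 7 := by
        have := Real.exp_nat_mul L 7
        push_cast at this
        rw [this, hLdef, Real.exp_log (by linarith)]
      rw [this]
      have h16 : (16:ℝ) ≤ (d:ℝ)^4 := by
        calc (16:ℝ) = 2 ^ 4 := by norm_num
          _ ≤ _ := pow_le_pow_left₀ (by norm_num) hd' 4
      calc (d : ℝ) * ((M + 1) * (M + 1)) ≤ d * ((3 * d) * (3 * d)) := by gcongr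
        _ = 9 * (d:ℝ) ^ 3 := by ring
        _ ≤ (d:ℝ) ^ 4 * (d:ℝ) ^ 3 := by gcongr; linarith
        _ = _ := by ring
    have h2 : (1 - ε / 2) ≤ Real.exp (-(ε / 2)) := by linarith [Real.add_one_le_exp (-(ε / 2))]
    calc ((d : ℝ) * ((M + 1) * (M + 1))) ^ K * (1 - ε / 2) ^ n
        ≤ (Real.exp (7 * L)) ^ K * (Real.exp (-(ε / 2))) ^ n := by
          have : 0 ≤ 1 - ε / 2 := by linarith
          gcongr
      _ = Real.exp (K * (7 * L) - n * (ε / 2)) := by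
          rw [← Real.exp_nat_mul, ← Real.exp_nat_mul, ← Real.exp_add]; ring_nf
      _ < 1 := by
          rw [Real.exp_lt_one_iff]
          have h3 : (n:ℝ) * ε ^ 2 = 100 * L * Real.log x := by
            rw [hεsq, hE]; field_simp
          have h4 : K * (7 * L) * ε ≤ 21 * L * Real.log (1 / ε) := by
            calc K * (7 * L) * ε ≤ (3 / ε * Real.log (1 / ε)) * (7 * L) * ε := by gcongr
              _ = _ := by field_simp; ring
          have h5 : 21 * L * Real.log (1 / ε) < n * (ε / 2) * ε := by
            have : 0 < L * Real.log (1 / ε) := by positivity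
            have : L * (2 * Real.log (1 / ε)) ≤ L * Real.log x := by gcongr
            nlinarith
          have := lt_of_mul_lt_mul_right (h4.trans_lt h5) hε0.le
          linarith
  obtain ⟨f, hf1, hf2⟩ := core d M K n ε hd0 hM0 hε0 hε1 hM1 (Nat.lt_floor_add_one _).le hcount
  exact minDisp_le n d hd0 ε hε0.le f hf1 hf2
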